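/- Let f₁ : ℝⁿ → ℝ be a function of the form f₁ = max(l₁, …, l_{n+1}) where (l₁, …, l_{n+1}) is an affinely independent family of affine functions, and let f₂ ∈ Υₙ(M_n − 1). Then f = f₁ + f₂ has minimal depth M_n. -/

import Mathlib

open Pointwise

noncomputable section

/-- `NN m n` is the set of functions `ℝⁿ → ℝ` representable by a ReLU neural network
with `m` hidden layers: `f = T⁽ᵐ⁺¹⁾ ∘ σ ∘ T⁽ᵐ⁾ ∘ σ ∘ ⋯ ∘ σ ∘ T⁽¹⁾` with each `T⁽ˡ⁾` affine
and `σ` the componentwise ReLU.  (`NN 0 n` is the set of affine functions.) -/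
def NN : ℕ → (n : ℕ) → Set ((Fin n → ℝ) → ℝ)
  | 0, n => {f | ∃ T : (Fin n → ℝ) →ᵃ[ℝ] ℝ, f = ⇑T}
  | m + 1, n => {f | ∃ (w : ℕ) (T : (Fin n → ℝ) →ᵃ[ℝ] (Fin w → ℝ)),
      ∃ g ∈ NN m w, f = fun x => g fun i => max (T x i) 0}

/-- Continuous piecewise linear functions `ℝⁿ → ℝ`: continuous functions that at each point
agree with one of finitely many affine functions. -/
def CPWL (n : ℕ) : Set ((Fin n → ℝ) → ℝ) :=
  {f | Continuous f ∧ ∃ s : Finset ((Fin n → ℝ) →ᵃ[ℝ] ℝ), ∀ x, ∃ g ∈ s, f x = g x}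

/-- `f` has minimal depth `m`: `f ∈ Υₙ(m)` and either `m = 0` or `f ∉ Υₙ(m-1)`. -/
def MinDepth (n : ℕ) (f : (Fin n → ℝ) → ℝ) (m : ℕ) : Prop :=
  f ∈ NN m n ∧ (m = 0 ∨ f ∉ NN (m - 1) n)

/-- `Mn n` is the least `m` such that `Υₙ = Υₙ(m)`. -/
def Mn (n : ℕ) : ℕ := sInf {m | CPWL n = NN m n}

section Networks

theorem NN_comp_affine {m n k : ℕ} {f : (Fin k → ℝ) → ℝ} (hf : f ∈ NN m k)
    (A : (Fin n → ℝ) →ᵃ[ℝ] (Fin k → ℝ)) : (fun x => f (A x)) ∈ NN m n := by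
  cases m with
  | zero =>
    obtain ⟨T, rfl⟩ := hf
    exact ⟨T.comp A, rfl⟩
  | succ m =>
    obtain ⟨w, T, g, hg, rfl⟩ := hf
    exact ⟨w, T.comp A, g, hg, rfl⟩

theorem NN_smul {m n : ℕ} (r : ℝ) {f : (Fin n → ℝ) → ℝ} (hf : f ∈ NN m n) :
    r • f ∈ NN m n := by
  induction m generalizing n with
  | zero =>
    obtain ⟨T, rfl⟩ := hf
    exact ⟨r • T, rfl⟩
  | succ m ih =>
    obtain ⟨w, T, g, hg, rfl⟩ := hf
    exact ⟨w, T, r • g, ih hg, rfl⟩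

/-- The affine map `x ↦ (A x, B x)`. -/
def affineAppend {p n k : ℕ} (A : (Fin p → ℝ) →ᵃ[ℝ] (Fin n → ℝ))
    (B : (Fin p → ℝ) →ᵃ[ℝ] (Fin k → ℝ)) : (Fin p → ℝ) →ᵃ[ℝ] (Fin (n + k) → ℝ) :=
  AffineMap.pi fun i => Fin.addCases
    (fun i => (LinearMap.proj (R := ℝ) (φ := fun _ => ℝ) i).toAffineMap.comp A)
    (fun i => (LinearMap.proj (R := ℝ) (φ := fun _ => ℝ) i).toAffineMap.comp B) i

@[simp]
theorem affineAppend_castAdd {p n k : ℕ} (A : (Fin p → ℝ) →ᵃ[ℝ] (Fin n → ℝ))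
    (B : (Fin p → ℝ) →ᵃ[ℝ] (Fin k → ℝ)) (x : Fin p → ℝ) (i : Fin n) :
    affineAppend A B x (Fin.castAdd k i) = A x i := by
  simp [affineAppend]

@[simp]
theorem affineAppend_natAdd {p n k : ℕ} (A : (Fin p → ℝ) →ᵃ[ℝ] (Fin n → ℝ))
    (B : (Fin p → ℝ) →ᵃ[ℝ] (Fin k → ℝ)) (x : Fin p → ℝ) (i : Fin k) :
    affineAppend A B x (Fin.natAdd n i) = B x i := by
  simp [affineAppend]

theorem NN_add_comp {m p n k : ℕ} {f : (Fin n → ℝ) → ℝ} {g : (Fin k → ℝ) → ℝ}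
    (hf : f ∈ NN m n) (hg : g ∈ NN m k) (A : (Fin p → ℝ) →ᵃ[ℝ] (Fin n → ℝ))
    (B : (Fin p → ℝ) →ᵃ[ℝ] (Fin k → ℝ)) : (fun x => f (A x) + g (B x)) ∈ NN m p := by
  induction m generalizing p n k with
  | zero =>
    obtain ⟨T, rfl⟩ := hf
    obtain ⟨S, rfl⟩ := hg
    exact ⟨T.comp A + S.comp B, rfl⟩
  | succ m ih =>
    obtain ⟨w, T, f', hf', rfl⟩ := hf
    obtain ⟨v, S, g', hg', rfl⟩ := hg
    refine ⟨w + v, affineAppend (T.comp A) (S.comp B), _,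
      ih hf' hg' (LinearMap.funLeft ℝ ℝ (Fin.castAdd v)).toAffineMap
        (LinearMap.funLeft ℝ ℝ (Fin.natAdd w)).toAffineMap, ?_⟩
    funext x
    simp [LinearMap.funLeft, Function.comp_def]

theorem NN_add {m n : ℕ} {f g : (Fin n → ℝ) → ℝ} (hf : f ∈ NN m n) (hg : g ∈ NN m n) :
    f + g ∈ NN m n :=
  NN_add_comp hf hg (AffineMap.id ℝ _) (AffineMap.id ℝ _)

theorem NN_sub {m n : ℕ} {f g : (Fin n → ℝ) → ℝ} (hf : f ∈ NN m n) (hg : g ∈ NN m n) :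
    f - g ∈ NN m n := by
  have := NN_add hf (NN_smul (-1) hg)
  rwa [neg_one_smul, ← sub_eq_add_neg] at this

theorem NN_relu {m n : ℕ} {f : (Fin n → ℝ) → ℝ} (hf : f ∈ NN m n) :
    (fun x => max (f x) 0) ∈ NN (m + 1) n := by
  induction m generalizing n with
  | zero =>
    obtain ⟨T, rfl⟩ := hf
    exact ⟨1, AffineMap.pi fun _ => T, fun y => y 0,
      ⟨(LinearMap.proj (R := ℝ) (φ := fun _ => ℝ) 0).toAffineMap, rfl⟩, rfl⟩
  | succ m ih =>
    obtain ⟨w, T, g, hg, rfl⟩ := hf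
    exact ⟨w, T, _, ih hg, rfl⟩

theorem NN_subset_succ (m n : ℕ) : NN m n ⊆ NN (m + 1) n := by
  intro f hf
  have h := NN_sub (NN_relu hf) (NN_relu (NN_smul (-1) hf))
  convert h using 1
  funext x
  simp only [Pi.sub_apply, Pi.smul_apply, smul_eq_mul]
  rcases le_total (f x) 0 with hx | hx
  · rw [max_eq_right hx, max_eq_left (by linarith)]; ring
  · rw [max_eq_left hx, max_eq_right (by linarith)]; ring

theorem NN_mono {m k : ℕ} (h : m ≤ k) (n : ℕ) : NN m n ⊆ NN k n :=
  monotone_nat_of_le_succ (f := fun m => NN m n) (fun m => NN_subset_succ m n) h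

theorem NN_affine (m : ℕ) {n : ℕ} (T : (Fin n → ℝ) →ᵃ[ℝ] ℝ) : ⇑T ∈ NN m n :=
  NN_mono (Nat.zero_le m) n ⟨T, rfl⟩

/-- `NN m n` as a linear subspace of the space of functions. -/
def NNSubmodule (m n : ℕ) : Submodule ℝ ((Fin n → ℝ) → ℝ) where
  carrier := NN m n
  add_mem' := NN_add
  zero_mem' := NN_affine m 0
  smul_mem' r _ hf := NN_smul r hf

theorem NN_sup {m n : ℕ} {f g : (Fin n → ℝ) → ℝ} (hf : f ∈ NN m n) (hg : g ∈ NN m n) :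
    f ⊔ g ∈ NN (m + 1) n := by
  convert NN_add (NN_subset_succ m n hf) (NN_relu (NN_sub hg hf)) using 1
  funext x
  simp only [Pi.sup_apply, Pi.add_apply, Pi.sub_apply]
  rcases le_total (f x) (g x) with hx | hx
  · rw [sup_eq_right.2 hx, max_eq_left (by linarith)]; ring
  · rw [sup_eq_left.2 hx, max_eq_right (by linarith)]; ring

theorem NN_subset_CPWL (m n : ℕ) : NN m n ⊆ CPWL n := by
  classical
  induction m generalizing n with
  | zero =>
    rintro _ ⟨T, rfl⟩
    exact ⟨T.continuous_of_finiteDimensional, {T}, fun x => ⟨T, by simp⟩⟩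
  | succ m ih =>
    rintro _ ⟨w, T, g, hg, rfl⟩
    obtain ⟨hc, s, hs⟩ := ih w hg
    have hT : Continuous T := T.continuous_of_finiteDimensional
    refine ⟨by fun_prop, (Finset.univ ×ˢ s).image fun q : Finset (Fin w) × _ =>
      q.2.comp (AffineMap.pi fun i => if i ∈ q.1 then
        (LinearMap.proj (R := ℝ) (φ := fun _ => ℝ) i).toAffineMap.comp T else 0), fun x => ?_⟩
    obtain ⟨l, hl, hx⟩ := hs fun i => max (T x i) 0
    refine ⟨_, Finset.mem_image_of_mem _ (Finset.mk_mem_product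
      (Finset.mem_univ (Finset.univ.filter fun i => 0 ≤ T x i)) hl), ?_⟩
    refine hx.trans ?_
    simp only [AffineMap.coe_comp, Function.comp_apply]
    congr 1
    funext i
    by_cases hi : 0 ≤ T x i
    · simp [hi]
    · simp [hi, (not_le.1 hi).le]

end Networks

section AffineMaxima

/-- A continuous function on the line that selects among finitely many affine functions
`t ↦ p i + t * q i` and vanishes at `0` and `1` has a component that is nonpositive at `0`
and nonnegative at `1`. -/
theorem exists_component_nonpos_nonneg {ι : Type*} (s : Finset ι) (p q : ι → ℝ) {F : ℝ → ℝ}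
    (hF : Continuous F) (hs : ∀ t, ∃ i ∈ s, F t = p i + t * q i) (h0 : F 0 = 0) (h1 : F 1 = 0) :
    ∃ i ∈ s, p i ≤ 0 ∧ 0 ≤ p i + q i := by
  by_contra! hcon
  -- a component that is active frequently near a point is active at that point
  have key : ∀ (u : ℝ) (l : Filter ℝ) (P : ℝ → Prop), l ≤ nhds u → (∃ᶠ t in l, P t) →
      ∃ i ∈ s, F u = p i + u * q i ∧ ∃ᶠ t in l, P t ∧ F t = p i + t * q i := by
    intro u l P hl hP
    have h : ∃ᶠ t in l, ∃ i ∈ s, P t ∧ F t = p i + t * q i :=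
      hP.mono fun t ht => by
        obtain ⟨i, hi, hti⟩ := hs t
        exact ⟨i, hi, ht, hti⟩
    have h' : ∃ i ∈ s, ∃ᶠ t in l, P t ∧ F t = p i + t * q i := by
      by_contra! hn
      refine h ?_
      have := (Filter.eventually_all_finset s).2 hn
      filter_upwards [this] with t ht ⟨i, hi, h⟩
      exact ht i hi h.1 h.2
    obtain ⟨i, hi, hfr⟩ := h'
    refine ⟨i, hi, ?_, hfr⟩
    have hcl : IsClosed {t | F t = p i + t * q i} := isClosed_eq hF (by fun_prop)
    exact hcl.mem_of_frequently_of_tendsto (hfr.mono fun t ht => ht.2) hl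
  have hneg : ∀ᶠ t in nhdsWithin (0 : ℝ) (Set.Ioi 0), F t < 0 := by
    by_contra hn
    rw [Filter.not_eventually] at hn
    obtain ⟨i, hi, hi0, hfr⟩ := key 0 _ _ nhdsWithin_le_nhds hn
    obtain ⟨t, ⟨ht, hti⟩, htpos⟩ := (hfr.and_eventually self_mem_nhdsWithin).exists
    have htpos : 0 < t := htpos
    have hp : p i = 0 := by linarith
    have := hcon i hi hp.le
    nlinarith
  obtain ⟨ε, hε, hεF⟩ := (mem_nhdsGT_iff_exists_Ioo_subset).1 hneg
  have hε : 0 < ε := hε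
  have hε1 : ε ≤ 1 := by
    by_contra! h
    have : F 1 < 0 := hεF ⟨one_pos, h⟩
    linarith
  obtain ⟨u, ⟨⟨hu0, hu1⟩, huF⟩, hmin⟩ :=
    (isCompact_Icc.inter_right (isClosed_le continuous_const hF) :
      IsCompact (Set.Icc (ε / 2) 1 ∩ {t | 0 ≤ F t})).exists_isLeast
      ⟨1, ⟨by linarith, le_rfl⟩, h1.ge⟩
  have huF : 0 ≤ F u := huF
  have hupos : 0 < u := by linarith
  have hlt : ∀ t, 0 < t → t < u → F t < 0 := by
    intro t ht htu
    by_contra! h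
    rcases lt_or_ge t (ε / 2) with h' | h'
    · have : F t < 0 := hεF ⟨ht, by linarith⟩
      linarith
    · exact absurd (hmin ⟨⟨h', by linarith⟩, h⟩) (not_le.2 htu)
  have hev : ∀ᶠ t in nhdsWithin u (Set.Iio u), 0 < t ∧ t < u ∧ F t < 0 := by
    filter_upwards [Ioo_mem_nhdsLT hupos] with t ht
    exact ⟨ht.1, ht.2, hlt t ht.1 ht.2⟩
  obtain ⟨i, hi, hui, hfr⟩ := key u _ _ nhdsWithin_le_nhds hev.frequently
  obtain ⟨t, ⟨ht0, htu, htF⟩, hti⟩ := hfr.exists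
  have hq : 0 < q i := by nlinarith
  have hu0 : F u = 0 := by
    refine le_antisymm ?_ huF
    exact le_of_tendsto (hF.continuousWithinAt (s := Set.Iio u) (x := u))
      (hev.mono fun t ht => ht.2.2.le)
  have := hcon i hi (by nlinarith)
  nlinarith

theorem CPWL_exists_component {n : ℕ} {f : (Fin n → ℝ) → ℝ} (hf : Continuous f)
    {s : Finset ((Fin n → ℝ) →ᵃ[ℝ] ℝ)} (hs : ∀ x, ∃ g ∈ s, f x = g x) (x y : Fin n → ℝ) :
    ∃ g ∈ s, g x ≤ f x ∧ f y ≤ g y := by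
  have hline : Continuous (AffineMap.lineMap x y : ℝ →ᵃ[ℝ] (Fin n → ℝ)) :=
    AffineMap.lineMap_continuous
  obtain ⟨g, hg, h0, h1⟩ := exists_component_nonpos_nonneg s
    (fun g => g x - f x) (fun g => (g y - f y) - (g x - f x))
    (F := fun t => f (AffineMap.lineMap x y t) - (f x + t * (f y - f x)))
    (by fun_prop)
    (fun t => by
      obtain ⟨g, hg, h⟩ := hs (AffineMap.lineMap x y t)
      refine ⟨g, hg, ?_⟩
      rw [h, AffineMap.apply_lineMap, AffineMap.lineMap_apply_ring]
      ring)
    (by simp) (by simp)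
  exact ⟨g, hg, by linarith, by linarith⟩

/-- `f` is the pointwise maximum of a finite nonempty set of affine functions. -/
def IsAffineMax {n : ℕ} (f : (Fin n → ℝ) → ℝ) : Prop :=
  ∃ (s : Finset ((Fin n → ℝ) →ᵃ[ℝ] ℝ)) (hs : s.Nonempty), f = fun x => s.sup' hs fun l => l x

theorem IsAffineMax.affine {n : ℕ} (l : (Fin n → ℝ) →ᵃ[ℝ] ℝ) : IsAffineMax ⇑l :=
  ⟨{l}, by simp, by simp⟩

theorem IsAffineMax.sup {n : ℕ} {f g : (Fin n → ℝ) → ℝ} (hf : IsAffineMax f)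
    (hg : IsAffineMax g) : IsAffineMax (f ⊔ g) := by
  classical
  obtain ⟨s, hs, rfl⟩ := hf
  obtain ⟨t, ht, rfl⟩ := hg
  exact ⟨s ∪ t, hs.mono Finset.subset_union_left, funext fun x => (Finset.sup'_union hs ht _).symm⟩

theorem IsAffineMax.add {n : ℕ} {f g : (Fin n → ℝ) → ℝ} (hf : IsAffineMax f)
    (hg : IsAffineMax g) : IsAffineMax (f + g) := by
  classical
  obtain ⟨s, hs, rfl⟩ := hf
  obtain ⟨t, ht, rfl⟩ := hg
  refine ⟨s + t, hs.add ht, funext fun x => le_antisymm ?_ ?_⟩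
  · obtain ⟨l, hl, hl'⟩ := s.exists_mem_eq_sup' hs fun l => l x
    obtain ⟨k, hk, hk'⟩ := t.exists_mem_eq_sup' ht fun l => l x
    simp only [Pi.add_apply, hl', hk']
    exact Finset.le_sup' (fun l : (Fin n → ℝ) →ᵃ[ℝ] ℝ => l x) (Finset.add_mem_add hl hk)
  · refine Finset.sup'_le _ _ fun b hb => ?_
    obtain ⟨l, hl, k, hk, rfl⟩ := Finset.mem_add.1 hb
    exact add_le_add (Finset.le_sup' (fun l : (Fin n → ℝ) →ᵃ[ℝ] ℝ => l x) hl)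
      (Finset.le_sup' (fun l : (Fin n → ℝ) →ᵃ[ℝ] ℝ => l x) hk)

/-- `f` is a difference of two finite maxima of affine functions. -/
def IsAffineMaxDiff {n : ℕ} (f : (Fin n → ℝ) → ℝ) : Prop :=
  ∃ g h, IsAffineMax g ∧ IsAffineMax h ∧ f = g - h

theorem IsAffineMaxDiff.affine {n : ℕ} (l : (Fin n → ℝ) →ᵃ[ℝ] ℝ) : IsAffineMaxDiff ⇑l :=
  ⟨l, _, .affine l, .affine 0, by ext; simp⟩

theorem IsAffineMaxDiff.sup {n : ℕ} {f g : (Fin n → ℝ) → ℝ} (hf : IsAffineMaxDiff f)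
    (hg : IsAffineMaxDiff g) : IsAffineMaxDiff (f ⊔ g) := by
  obtain ⟨a, b, ha, hb, rfl⟩ := hf
  obtain ⟨c, d, hc, hd, rfl⟩ := hg
  refine ⟨(a + d) ⊔ (c + b), b + d, (ha.add hd).sup (hc.add hb), hb.add hd, funext fun x => ?_⟩
  simp only [Pi.sup_apply, Pi.sub_apply, Pi.add_apply]
  rw [← max_sub_sub_right]
  congr 1 <;> ring

theorem IsAffineMaxDiff.inf {n : ℕ} {f g : (Fin n → ℝ) → ℝ} (hf : IsAffineMaxDiff f)
    (hg : IsAffineMaxDiff g) : IsAffineMaxDiff (f ⊓ g) := by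
  obtain ⟨a, b, ha, hb, rfl⟩ := hf
  obtain ⟨c, d, hc, hd, rfl⟩ := hg
  refine ⟨a + c, (a + d) ⊔ (c + b), ha.add hc, (ha.add hd).sup (hc.add hb), funext fun x => ?_⟩
  simp only [Pi.sup_apply, Pi.inf_apply, Pi.sub_apply, Pi.add_apply]
  rcases le_total (a x - b x) (c x - d x) with h | h
  · rw [inf_eq_left.2 h, sup_eq_right.2 (by linarith)]; ring
  · rw [inf_eq_right.2 h, sup_eq_left.2 (by linarith)]; ring

theorem CPWL.isAffineMaxDiff {n : ℕ} {f : (Fin n → ℝ) → ℝ} (hf : f ∈ CPWL n) :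
    IsAffineMaxDiff f := by
  classical
  obtain ⟨hc, s, hs⟩ := hf
  have key := CPWL_exists_component hc hs
  -- the components lying above `f` at `y`
  let S : (Fin n → ℝ) → Finset ((Fin n → ℝ) →ᵃ[ℝ] ℝ) := fun y => s.filter fun g => f y ≤ g y
  have hS : ∀ y, (S y).Nonempty := fun y => by
    obtain ⟨g, hg, -, h⟩ := key y y
    exact ⟨g, Finset.mem_filter.2 ⟨hg, h⟩⟩
  let φ : (Fin n → ℝ) → (Fin n → ℝ) → ℝ := fun y => (S y).inf' (hS y) fun g => ⇑g
  have hφ : ∀ y, IsAffineMaxDiff (φ y) := fun y =>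
    Finset.inf'_induction _ _ (fun _ ha _ hb => ha.inf hb) fun g _ => .affine g
  have hfin : (Set.range φ).Finite := by
    have : (Set.range S).Finite := s.powerset.finite_toSet.subset (by
      rintro _ ⟨y, rfl⟩
      exact Finset.mem_coe.2 (Finset.mem_powerset.2 (Finset.filter_subset _ _)))
    refine Set.Finite.subset (this.image fun T : Finset ((Fin n → ℝ) →ᵃ[ℝ] ℝ) =>
      if h : T.Nonempty then T.inf' h fun g => ⇑g else 0) ?_
    rintro _ ⟨y, rfl⟩
    exact ⟨S y, ⟨y, rfl⟩, by simp [hS y, φ]⟩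
  have hne : hfin.toFinset.Nonempty := by simpa using Set.range_nonempty φ
  have hrep : f = hfin.toFinset.sup' hne id := by
    refine le_antisymm (fun x => ?_) ?_
    · have h1 : f x ≤ φ x x := by
        simp only [φ, Finset.inf'_apply]
        exact Finset.le_inf' _ _ fun g hg => (Finset.mem_filter.1 hg).2
      exact h1.trans (Finset.le_sup' (f := id) (by simp : φ x ∈ hfin.toFinset) x)
    · refine Finset.sup'_le _ _ fun ψ hψ => ?_
      obtain ⟨y, rfl⟩ := hfin.mem_toFinset.1 hψ
      intro x
      obtain ⟨g, hg, hx, hy⟩ := key x y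
      exact (Finset.inf'_le (fun g : (Fin n → ℝ) →ᵃ[ℝ] ℝ => ⇑g)
        (Finset.mem_filter.2 ⟨hg, hy⟩) x).trans hx
  rw [hrep]
  refine Finset.sup'_induction _ _ (fun _ ha _ hb => ha.sup hb) fun ψ hψ => ?_
  obtain ⟨y, rfl⟩ := hfin.mem_toFinset.1 hψ
  exact hφ y

end AffineMaxima

section Reduction

theorem sum_powerset_neg_one_pow_card_mul_sup' {ι : Type*} [DecidableEq ι] (v : ι → ℝ)
    {P R : Finset ι} (hR : R.Nonempty) {i : ι} (hi : i ∈ P) (hiR : v i ≤ R.sup' hR v) :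
    ∑ S ∈ P.powerset, (-1 : ℝ) ^ S.card *
      (S ∪ R).sup' (hR.mono Finset.subset_union_right) v = 0 := by
  rw [← Finset.insert_erase hi, Finset.sum_powerset_insert (Finset.notMem_erase i P),
    ← Finset.sum_add_distrib]
  refine Finset.sum_eq_zero fun S hS => ?_
  have hiS : i ∉ S := fun h => Finset.notMem_erase i P (Finset.mem_powerset.1 hS h)
  have hsup : (insert i S ∪ R).sup' (hR.mono Finset.subset_union_right) v =
      (S ∪ R).sup' (hR.mono Finset.subset_union_right) v := by
    have hne : (S ∪ R).Nonempty := hR.mono Finset.subset_union_right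
    simp only [Finset.insert_union]
    rw [Finset.sup'_insert (H := hne)]
    exact sup_eq_right.2 (hiR.trans (Finset.sup'_mono v Finset.subset_union_right hR))
  rw [Finset.card_insert_of_notMem hiS, hsup, pow_succ]
  ring

/-- More than `n + 1` affine functions on `ℝⁿ` satisfy a nontrivial relation with coefficients
summing to zero whose value is a nonpositive constant. -/
theorem exists_affine_relation {n : ℕ} (s : Finset ((Fin n → ℝ) →ᵃ[ℝ] ℝ))
    (hs : n + 1 < s.card) :
    ∃ c : ((Fin n → ℝ) →ᵃ[ℝ] ℝ) → ℝ, ∑ l ∈ s, c l = 0 ∧ (∃ l ∈ s, c l ≠ 0) ∧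
      ∀ x, ∑ l ∈ s, c l * l x ≤ 0 := by
  classical
  have hdep : ¬ LinearIndependent ℝ
      (fun l : s => ((l.1.linear, (1 : ℝ)) : ((Fin n → ℝ) →ₗ[ℝ] ℝ) × ℝ)) := by
    intro h
    have hcard := h.fintype_card_le_finrank
    rw [Fintype.card_coe, Module.finrank_prod, Module.finrank_self] at hcard
    have : Module.finrank ℝ ((Fin n → ℝ) →ₗ[ℝ] ℝ) = n := by
      simp
    omega
  obtain ⟨c, hc, l₀, hl₀⟩ := Fintype.not_linearIndependent_iff.1 hdep
  have hlin : ∑ l : s, c l • l.1.linear = 0 := by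
    simpa [Prod.fst_sum] using congrArg Prod.fst hc
  have hone : ∑ l : s, c l = 0 := by
    simpa [Prod.snd_sum] using congrArg Prod.snd hc
  have hconst : ∀ x, ∑ l : s, c l * l.1 x = ∑ l : s, c l * l.1 0 := by
    intro x
    have h := LinearMap.congr_fun hlin x
    simp only [LinearMap.coe_sum, Finset.sum_apply, LinearMap.smul_apply, smul_eq_mul,
      LinearMap.zero_apply] at h
    rw [← sub_eq_zero, ← Finset.sum_sub_distrib, ← h]
    refine Finset.sum_congr rfl fun l _ => ?_
    have := congrFun l.1.decomp x
    simp only [Pi.add_apply] at this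
    rw [this]
    ring
  -- a relation over the subtype gives one over the finset
  have extend : ∀ d : s → ℝ, ∑ l, d l = 0 → (∃ l, d l ≠ 0) → (∀ x, ∑ l, d l * l.1 x ≤ 0) →
      ∃ c : ((Fin n → ℝ) →ᵃ[ℝ] ℝ) → ℝ, ∑ l ∈ s, c l = 0 ∧ (∃ l ∈ s, c l ≠ 0) ∧
        ∀ x, ∑ l ∈ s, c l * l x ≤ 0 := by
    rintro d h1 ⟨l, hl⟩ h2
    refine ⟨fun l => if h : l ∈ s then d ⟨l, h⟩ else 0, ?_, ⟨l.1, l.2, by simpa using hl⟩,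
      fun x => ?_⟩
    · rw [← Finset.sum_coe_sort]; simpa using h1
    · rw [← Finset.sum_coe_sort]; simpa using h2 x
  rcases le_total (∑ l : s, c l * l.1 0) 0 with h | h
  · exact extend c hone ⟨l₀, hl₀⟩ fun x => (hconst x).trans_le h
  · refine extend (-c) (by simpa using hone) ⟨l₀, by simpa using hl₀⟩ fun x => ?_
    have := hconst x
    simp only [Pi.neg_apply, neg_mul, Finset.sum_neg_distrib]
    linarith

/-- A linear space of functions on `ℝⁿ` containing all maxima of `n + 1` affine functions contains
all finite maxima of affine functions. -/
theorem IsAffineMax.mem_submodule {n : ℕ} (W : Submodule ℝ ((Fin n → ℝ) → ℝ))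
    (hW : ∀ l : Fin (n + 1) → ((Fin n → ℝ) →ᵃ[ℝ] ℝ), (fun x => ⨆ i, l i x) ∈ W)
    {f : (Fin n → ℝ) → ℝ} (hf : IsAffineMax f) : f ∈ W := by
  classical
  obtain ⟨s, hs, rfl⟩ := hf
  induction hk : s.card using Nat.strong_induction_on generalizing s with
  | _ k ih =>
  subst hk
  rcases le_or_gt s.card (n + 1) with hcard | hcard
  · have : Nonempty s := hs.to_subtype
    obtain ⟨e⟩ : Nonempty (s ↪ Fin (n + 1)) :=
      Function.Embedding.nonempty_of_card_le (by simpa using hcard)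
    have he : Function.Surjective (Function.invFun e) := Function.invFun_surjective e.injective
    convert hW fun i => (Function.invFun e i).1 using 1
    funext x
    rw [he.iSup_comp (g := fun l : s => l.1 x), Finset.sup'_eq_csSup_image, sSup_image']
    rfl
  · obtain ⟨c, hsum, ⟨l₀, hl₀, hc₀⟩, hrel⟩ := exists_affine_relation s hcard
    set P := s.filter fun l => 0 < c l with hP
    set R := s.filter fun l => ¬ 0 < c l with hR
    have hPR : P ∪ R = s := Finset.filter_union_filter_not_eq _ s
    have hPne : P.Nonempty := by
      obtain ⟨l, hl, h⟩ := Finset.exists_pos_of_sum_zero_of_exists_nonzero c hsum ⟨l₀, hl₀, hc₀⟩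
      exact ⟨l, Finset.mem_filter.2 ⟨hl, h⟩⟩
    have hRne : R.Nonempty := by
      by_contra hne
      rw [Finset.not_nonempty_iff_eq_empty] at hne
      have hall : ∀ l ∈ s, 0 < c l := by
        intro l hl
        rw [← hPR, hne, Finset.union_empty] at hl
        exact (Finset.mem_filter.1 hl).2
      exact (Finset.sum_pos hall hs).ne' hsum
    have hcover : ∀ x, ∃ l ∈ P, l x ≤ R.sup' hRne fun l => l x := by
      intro x
      by_contra! hgt
      set M := R.sup' hRne fun l => l x
      have hpos : 0 < ∑ l ∈ s, c l * (l x - M) := by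
        obtain ⟨p, hp⟩ := hPne
        have hps := Finset.mem_filter.1 hp
        refine Finset.sum_pos' (fun l hl => ?_)
          ⟨p, hps.1, mul_pos hps.2 (sub_pos.2 (hgt p hp))⟩
        by_cases h : 0 < c l
        · exact (mul_pos h (sub_pos.2 (hgt l (Finset.mem_filter.2 ⟨hl, h⟩)))).le
        · exact mul_nonneg_of_nonpos_of_nonpos (not_lt.1 h) (sub_nonpos.2
            (Finset.le_sup' (fun l : (Fin n → ℝ) →ᵃ[ℝ] ℝ => l x)
              (Finset.mem_filter.2 ⟨hl, h⟩)))
      have := hrel x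
      simp only [mul_sub, Finset.sum_sub_distrib, ← Finset.sum_mul, hsum, zero_mul,
        sub_zero] at hpos
      linarith
    have hne : ∀ S : Finset ((Fin n → ℝ) →ᵃ[ℝ] ℝ), (S ∪ R).Nonempty := fun S =>
      hRne.mono Finset.subset_union_right
    have hrep : (fun x => s.sup' hs fun l => l x) = (-(-1 : ℝ) ^ P.card) •
        ∑ S ∈ P.ssubsets, (-1 : ℝ) ^ S.card • fun x => (S ∪ R).sup' (hne S) fun l => l x := by
      funext x
      obtain ⟨l, hl, hlx⟩ := hcover x
      have h := sum_powerset_neg_one_pow_card_mul_sup' (fun l : (Fin n → ℝ) →ᵃ[ℝ] ℝ => l x)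
        hRne hl hlx
      rw [← Finset.insert_erase (Finset.mem_powerset_self P),
        Finset.sum_insert (Finset.notMem_erase _ _)] at h
      simp only [hPR] at h
      have hsq : (-1 : ℝ) ^ P.card * (-1) ^ P.card = 1 := by
        rw [← mul_pow]; simp
      simp only [Pi.smul_apply, Finset.sum_apply, smul_eq_mul, Finset.ssubsets]
      rw [eq_neg_of_add_eq_zero_right h]
      linear_combination (-(s.sup' hs fun l => l x)) * hsq
    rw [hrep]
    refine W.smul_mem _ (W.sum_mem fun S hS => W.smul_mem _ (ih _ ?_ _ (hne S) rfl))
    refine Finset.card_lt_card ?_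
    have hSP : S ⊂ P := Finset.mem_ssubsets.1 hS
    obtain ⟨l, hl, hlS⟩ := Finset.exists_of_ssubset hSP
    have hls := Finset.mem_filter.1 hl
    refine (Finset.ssubset_iff_of_subset ?_).2 ⟨l, hls.1, fun h => ?_⟩
    · rw [← hPR]; exact Finset.union_subset_union_left hSP.subset
    · rcases Finset.mem_union.1 h with h | h
      · exact hlS h
      · exact (Finset.mem_filter.1 h).2 hls.2

end Reduction

section Depth

/-- Up to an affine substitution and an affine summand, a maximum of `n + 1` affine functions with
affinely independent coefficient vectors yields every maximum of `n + 1` affine functions. -/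
theorem iSup_mem_NN_of_affineIndependent {m n : ℕ} {a : Fin (n + 1) → Fin n → ℝ}
    {c : Fin (n + 1) → ℝ} (ha : AffineIndependent ℝ a)
    (h : (fun x : Fin n → ℝ => ⨆ i, ((∑ j, a i j * x j) + c i)) ∈ NN m n)
    (l : Fin (n + 1) → ((Fin n → ℝ) →ᵃ[ℝ] ℝ)) : (fun x => ⨆ i, l i x) ∈ NN m n := by
  let B : Matrix (Fin n) (Fin n) ℝ := Matrix.of fun i j => a i.succ j - a 0 j
  have hB : IsUnit B := by
    rw [← Matrix.linearIndependent_rows_iff_isUnit]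
    have hli := (affineIndependent_iff_linearIndependent_vsub ℝ a 0).1 ha
    exact hli.comp (fun i : Fin n => ⟨i.succ, Fin.succ_ne_zero i⟩)
      fun i j hij => Fin.succ_injective n (congrArg Subtype.val hij)
  let A : (Fin n → ℝ) →ᵃ[ℝ] (Fin n → ℝ) := (Matrix.mulVecLin B⁻¹).toAffineMap.comp
    (AffineMap.pi fun i => l i.succ - l 0 - AffineMap.const ℝ _ (c i.succ - c 0))
  have hA : ∀ x i, ∑ j, (a (Fin.succ i) j - a 0 j) * A x j =
      l i.succ x - l 0 x - (c i.succ - c 0) := by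
    intro x i
    have hdet := (Matrix.isUnit_iff_isUnit_det B).1 hB
    have : B.mulVec (A x) = fun i : Fin n => l i.succ x - l 0 x - (c i.succ - c 0) := by
      simp only [A, AffineMap.coe_comp, Function.comp_apply, LinearMap.coe_toAffineMap,
        Matrix.mulVecLin_apply, Matrix.mulVec_mulVec, Matrix.mul_nonsing_inv _ hdet,
        Matrix.one_mulVec]
      rfl
    exact congrFun this i
  let a₀ : (Fin n → ℝ) →ₗ[ℝ] ℝ := ∑ j, a 0 j • LinearMap.proj j
  let r : (Fin n → ℝ) →ᵃ[ℝ] ℝ := a₀.toAffineMap.comp A + AffineMap.const ℝ _ (c 0) - l 0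
  have hr : ∀ x, r x = (∑ j, a 0 j * A x j) + c 0 - l 0 x := by
    intro x
    simp [r, a₀]
  convert NN_sub (NN_comp_affine h A) (NN_affine m r) using 1
  funext x
  have hcomp : ∀ i, (∑ j, a i j * A x j) + c i = l i x + r x := by
    intro i
    rw [hr]
    refine Fin.cases (by ring) (fun i => ?_) i
    have := hA x i
    simp only [sub_mul, Finset.sum_sub_distrib] at this
    linarith
  simp only [Pi.sub_apply, hcomp]
  rw [← ciSup_add (Set.finite_range fun i => l i x).bddAbove]
  ring

theorem CPWL_eq_NN_of_affineIndependent {m n : ℕ} {a : Fin (n + 1) → Fin n → ℝ}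
    {c : Fin (n + 1) → ℝ} (ha : AffineIndependent ℝ a)
    (h : (fun x : Fin n → ℝ => ⨆ i, ((∑ j, a i j * x j) + c i)) ∈ NN m n) :
    CPWL n = NN m n := by
  refine (NN_subset_CPWL m n).antisymm' fun f hf => ?_
  obtain ⟨g, k, hg, hk, rfl⟩ := CPWL.isAffineMaxDiff hf
  have hW := iSup_mem_NN_of_affineIndependent ha h
  exact NN_sub (hg.mem_submodule (NNSubmodule m n) hW) (hk.mem_submodule (NNSubmodule m n) hW)

theorem exists_iSup_affine_mem_NN {n : ℕ} (a : Fin (n + 1) → Fin n → ℝ) (c : Fin (n + 1) → ℝ) :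
    ∃ m, (fun x : Fin n → ℝ => ⨆ i, ((∑ j, a i j * x j) + c i)) ∈ NN m n := by
  let l : Fin (n + 1) → (Fin n → ℝ) →ᵃ[ℝ] ℝ := fun i =>
    (∑ j, a i j • LinearMap.proj (R := ℝ) (φ := fun _ => ℝ) j).toAffineMap +
      AffineMap.const ℝ _ (c i)
  have hrep : (fun x : Fin n → ℝ => ⨆ i, ((∑ j, a i j * x j) + c i)) =
      Finset.univ.sup' Finset.univ_nonempty fun i => ⇑(l i) := by
    funext x
    simp [Finset.sup'_apply, Finset.sup'_univ_eq_ciSup, l]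
  rw [hrep]
  refine Finset.sup'_induction (p := fun f => ∃ m, f ∈ NN m n) _ _ ?_ fun i _ => ⟨0, l i, rfl⟩
  rintro f ⟨m, hf⟩ g ⟨k, hg⟩
  exact ⟨max m k + 1, NN_sup (NN_mono (le_max_left m k) n hf) (NN_mono (le_max_right m k) n hg)⟩

end Depth

/-- If `f₁ = max(l₁, …, l_{n+1})` with `(l₁, …, l_{n+1})` an affinely
independent family of affine functions `lᵢ(x) = aᵢ·x + cᵢ`, and `f₂ ∈ Υₙ(Mₙ - 1)`, then
`f₁ + f₂` has minimal depth `Mₙ`. -/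
theorem statement12 (n : ℕ) (a : Fin (n + 1) → Fin n → ℝ) (c : Fin (n + 1) → ℝ)
    (ha : AffineIndependent ℝ a)
    (f₂ : (Fin n → ℝ) → ℝ) (hf₂ : f₂ ∈ NN (Mn n - 1) n) :
    MinDepth n (fun x => (⨆ i, ((∑ j, a i j * x j) + c i)) + f₂ x) (Mn n) := by
  obtain ⟨m, hm⟩ := exists_iSup_affine_mem_NN a c
  have hmem : CPWL n = NN (Mn n) n :=
    Nat.sInf_mem (s := {m | CPWL n = NN m n}) ⟨m, CPWL_eq_NN_of_affineIndependent ha hm⟩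
  have hf₁ : (fun x : Fin n → ℝ => ⨆ i, ((∑ j, a i j * x j) + c i)) ∈ NN (Mn n) n :=
    hmem ▸ NN_subset_CPWL m n hm
  refine ⟨NN_add hf₁ (NN_mono (Nat.sub_le _ _) n hf₂), or_iff_not_imp_left.2 fun h0 hf => ?_⟩
  have hsub := NN_sub hf hf₂
  have hf₁' : (fun x : Fin n → ℝ => ⨆ i, ((∑ j, a i j * x j) + c i)) ∈ NN (Mn n - 1) n := by
    convert hsub using 1
    funext x
    simp
  have hle : Mn n ≤ Mn n - 1 := Nat.sInf_le (CPWL_eq_NN_of_affineIndependent ha hf₁')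
  omega
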